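/- Let (Z,d,ν) be a bounded metric measure space that is Ahlfors–David D-regular for some D > 0, and let 1 < p < ∞. Then W^{log,p}(Z) is compactly embedded in L^p(ν): every subset of W^{log,p}(Z) that is bounded in the ‖·‖_{W^{log,p}}-norm is relatively compact in L^p(ν). -/

import Mathlib

open MeasureTheory Metric ENNReal

/-- A bounded set that can be approximated arbitrarily well by finite-dimensional subspaces is
totally bounded. -/
lemma totallyBounded_of_forall_exists_finiteDimensional {E : Type*} [NormedAddCommGroup E]
    [NormedSpace ℂ E] {S : Set E} {R : ℝ} (hR : ∀ x ∈ S, ‖x‖ ≤ R)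
    (h : ∀ ε : ℝ, 0 < ε → ∃ F : Submodule ℂ E, FiniteDimensional ℂ F ∧
      ∀ x ∈ S, ∃ y ∈ F, dist x y ≤ ε) : TotallyBounded S := by
  rw [Metric.totallyBounded_iff]
  intro ε hε
  obtain ⟨F, hF, hSF⟩ := h (ε / 2) (by positivity)
  have : ProperSpace F := FiniteDimensional.proper ℂ F
  have hK : IsCompact ((fun y : F ↦ (y : E)) '' closedBall (0 : F) (R + ε / 2)) :=
    (isCompact_closedBall _ _).image continuous_subtype_val
  obtain ⟨t, ht, hcov⟩ := Metric.totallyBounded_iff.1 hK.totallyBounded (ε / 2) (by positivity)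
  refine ⟨t, ht, fun x hx ↦ ?_⟩
  obtain ⟨y, hyF, hxy⟩ := hSF x hx
  have hy : y ∈ (fun y : F ↦ (y : E)) '' closedBall (0 : F) (R + ε / 2) := by
    refine ⟨⟨y, hyF⟩, ?_, rfl⟩
    rw [mem_closedBall_zero_iff]
    change ‖y‖ ≤ _
    have h1 := hR x hx
    rw [dist_comm, dist_eq_norm] at hxy
    have h2 := norm_sub_norm_le y x
    linarith
  obtain ⟨z, hz, hyz⟩ := Set.mem_iUnion₂.1 (hcov hy)
  refine Set.mem_iUnion₂.2 ⟨z, hz, ?_⟩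
  rw [mem_ball] at hyz ⊢
  linarith [dist_triangle x y z]

lemma enorm_sub_integral_rpow_le {α : Type*} [MeasurableSpace α] (μ : Measure α)
    [IsProbabilityMeasure μ] {p : ℝ} (hp : 1 ≤ p) {f : α → ℂ} (hf : Integrable f μ) (a : ℂ) :
    ‖a - ∫ η, f η ∂μ‖ₑ ^ p ≤ ∫⁻ η, ‖a - f η‖ₑ ^ p ∂μ := by
  have hp0 : 0 < p := by linarith
  have h1 : a - ∫ η, f η ∂μ = ∫ η, (a - f η) ∂μ := by
    rw [integral_sub (integrable_const a) hf]
    simp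
  have h2 : ‖a - ∫ η, f η ∂μ‖ₑ ≤ eLpNorm (fun η ↦ a - f η) (ENNReal.ofReal p) μ := by
    rw [h1]
    refine (enorm_integral_le_lintegral_enorm _).trans ?_
    rw [← eLpNorm_one_eq_lintegral_enorm]
    exact eLpNorm_le_eLpNorm_of_exponent_le (by simpa using ENNReal.ofReal_le_ofReal hp)
      (aestronglyMeasurable_const.sub hf.1)
  refine (ENNReal.rpow_le_rpow h2 hp0.le).trans (le_of_eq ?_)
  rw [eLpNorm_eq_lintegral_rpow_enorm_toReal (by simpa using hp0) ENNReal.ofReal_ne_top,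
    ENNReal.toReal_ofReal hp0.le, ← ENNReal.rpow_mul, one_div, inv_mul_cancel₀ hp0.ne',
    ENNReal.rpow_one]

lemma enorm_sub_setAverage_rpow_le {α : Type*} [MeasurableSpace α] (μ : Measure α)
    [IsFiniteMeasure μ] {p : ℝ} (hp : 1 ≤ p) {f : α → ℂ} (hf : Integrable f μ) (a : ℂ)
    {s : Set α} (hs : μ s ≠ 0) :
    ‖a - ⨍ η in s, f η ∂μ‖ₑ ^ p ≤ (μ s)⁻¹ * ∫⁻ η in s, ‖a - f η‖ₑ ^ p ∂μ := by
  rw [setAverage_eq']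
  have : IsProbabilityMeasure ((μ s)⁻¹ • μ.restrict s) :=
    ⟨by simp [ENNReal.inv_mul_cancel hs (measure_ne_top μ s)]⟩
  refine (enorm_sub_integral_rpow_le _ hp
    (hf.restrict.smul_measure (ENNReal.inv_ne_top.2 hs)) a).trans ?_
  rw [lintegral_smul_measure, smul_eq_mul]

lemma lintegral_enorm_sub_setAverage_le {Z : Type*} [MetricSpace Z] [MeasurableSpace Z]
    [BorelSpace Z] (ν : Measure Z) [IsFiniteMeasure ν] {p : ℝ} (hp : 1 ≤ p) {f : Z → ℂ}
    (hf : Integrable f ν) {σ : Z → Z} {δ : ℝ} (hσ : ∀ x, dist x (σ x) ≤ δ) {m : ℝ≥0∞}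
    (hm : m ≠ 0) (hmν : ∀ z, m ≤ ν (closedBall z δ)) :
    ∫⁻ ξ, ‖f ξ - ⨍ η in closedBall (σ ξ) δ, f η ∂ν‖ₑ ^ p ∂ν ≤
      ∫⁻ ξ, m⁻¹ * ∫⁻ η in closedBall ξ (2 * δ), ‖f ξ - f η‖ₑ ^ p ∂ν ∂ν := by
  refine lintegral_mono fun ξ ↦ ?_
  have h0 : ν (closedBall (σ ξ) δ) ≠ 0 := fun h ↦ hm (le_zero_iff.1 (h ▸ hmν (σ ξ)))
  refine (enorm_sub_setAverage_rpow_le ν hp hf _ h0).trans ?_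
  refine mul_le_mul' (ENNReal.inv_le_inv.2 (hmν _)) (lintegral_mono_set ?_)
  refine closedBall_subset_closedBall' ?_
  rw [dist_comm]
  linarith [hσ ξ]

/-- Functions factoring through a given simple function span a finite-dimensional subspace
of `Lᵖ`. -/
lemma exists_finiteDimensional_forall_comp_mem {Z : Type*} [MeasurableSpace Z] (ν : Measure Z)
    [IsFiniteMeasure ν] (q : ℝ≥0∞) [Fact (1 ≤ q)] (σ : SimpleFunc Z Z) :
    ∃ F : Submodule ℂ (Lp ℂ q ν), FiniteDimensional ℂ F ∧ ∀ a : Z → ℂ,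
      ((σ.map a).memLp_of_isFiniteMeasure q ν).toLp ∈ F := by
  let L : (Z → ℂ) →ₗ[ℂ] Lp ℂ q ν :=
    { toFun := fun a ↦ ((σ.map a).memLp_of_isFiniteMeasure q ν).toLp
      map_add' := fun a b ↦ rfl
      map_smul' := fun a b ↦ rfl }
  let G : (σ.range → ℂ) →ₗ[ℂ] (Z → ℂ) :=
    Function.ExtendByZero.linearMap ℂ (Subtype.val : σ.range → Z)
  refine ⟨LinearMap.range (L ∘ₗ G), inferInstance, fun a ↦ ⟨fun z ↦ a z, ?_⟩⟩
  refine congrArg (fun s : SimpleFunc Z ℂ ↦ (s.memLp_of_isFiniteMeasure q ν).toLp)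
    (SimpleFunc.ext fun x ↦ ?_ : σ.map (G fun z ↦ a z) = σ.map a)
  exact Subtype.val_injective.extend_apply (fun z : σ.range ↦ a z) 0 ⟨σ x, σ.mem_range_self x⟩

lemma exists_finset_forall_dist_le {Z : Type*} [MetricSpace Z] [MeasurableSpace Z]
    [BorelSpace Z] (ν : Measure Z) [IsFiniteMeasure ν] {δ : ℝ} {m : ℝ≥0∞} (hm : m ≠ 0)
    (hmν : ∀ z, m ≤ ν (closedBall z (δ / 2))) :
    ∃ t : Finset Z, ∀ y, ∃ x ∈ t, dist x y ≤ δ := by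
  by_contra! h
  obtain ⟨f, -, hf⟩ := exists_seq_of_forall_finset_exists (fun _ : Z ↦ True)
    (fun x y ↦ δ < dist x y) fun s _ ↦ (h s).imp fun y hy ↦ ⟨trivial, hy⟩
  have hdisj : Pairwise (Function.onFun Disjoint fun n ↦ closedBall (f n) (δ / 2)) := by
    intro i j hij
    refine closedBall_disjoint_closedBall ?_
    rcases hij.lt_or_gt with h | h
    · linarith [hf i j h]
    · rw [dist_comm]
      linarith [hf j i h]
  have hfin := Measure.finite_const_le_meas_of_disjoint_iUnion ν (pos_iff_ne_zero.2 hm)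
    (fun n ↦ measurableSet_closedBall) hdisj (measure_ne_top ν _)
  refine Set.infinite_univ (hfin.subset fun n _ ↦ hmν (f n))

lemma exists_simpleFunc_forall_dist_le {Z : Type*} [MetricSpace Z] [MeasurableSpace Z]
    [BorelSpace Z] [Nonempty Z] {δ : ℝ} (h : ∃ t : Finset Z, ∀ y, ∃ x ∈ t, dist x y ≤ δ) :
    ∃ σ : SimpleFunc Z Z, ∀ x, dist x (σ x) ≤ δ := by
  obtain ⟨t, ht⟩ := h
  let e : ℕ → Z := fun n ↦ t.toList.getD n (Classical.arbitrary Z)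
  refine ⟨SimpleFunc.nearestPt e t.toList.length, fun y ↦ ?_⟩
  obtain ⟨x, hx, hxy⟩ := ht y
  obtain ⟨n, hn, hnx⟩ := List.getElem_of_mem (Finset.mem_toList.2 hx)
  have h1 := SimpleFunc.edist_nearestPt_le e y hn.le
  have h2 : e n = x := (List.getD_eq_getElem _ _ hn).trans hnx
  rw [h2, edist_dist, edist_dist, ENNReal.ofReal_le_ofReal_iff dist_nonneg] at h1
  rw [dist_comm]
  exact h1.trans hxy

lemma sum_geometric_ite_le {q u X : ℝ} (hq : 1 < q) (hu : 0 ≤ u) (hX : 0 ≤ X) (N : ℕ) :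
    ∑ k ∈ Finset.range N, (if u * q ^ k ≤ X then u * q ^ k else 0) ≤ X * (q / (q - 1)) := by
  have hq1 : 0 < q - 1 := by linarith
  induction N with
  | zero => simpa using mul_nonneg hX (div_nonneg (by linarith) hq1.le)
  | succ N ih =>
    by_cases hN : u * q ^ N ≤ X
    · calc ∑ k ∈ Finset.range (N + 1), (if u * q ^ k ≤ X then u * q ^ k else 0)
          ≤ ∑ k ∈ Finset.range (N + 1), u * q ^ k := by
            refine Finset.sum_le_sum fun k _ ↦ ?_
            split_ifs
            · exact le_rfl
            · positivity
        _ = u * ((q ^ (N + 1) - 1) / (q - 1)) := by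
            rw [← Finset.mul_sum, geom_sum_eq hq.ne']
        _ ≤ X * (q / (q - 1)) := by
            rw [← mul_div_assoc, ← mul_div_assoc]
            refine div_le_div_of_nonneg_right ?_ hq1.le
            have : u * q ^ N * q ≤ X * q := mul_le_mul_of_nonneg_right hN (by linarith)
            rw [pow_succ]
            nlinarith
    · rw [Finset.sum_range_succ, if_neg hN, add_zero]
      exact ih

lemma sum_lintegral_le {α : Type*} [MeasurableSpace α] (μ : Measure α) (g : ℕ → α → ℝ≥0∞)
    (N : ℕ) : ∑ k ∈ Finset.range N, ∫⁻ x, g k x ∂μ ≤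
      ∫⁻ x, ∑ k ∈ Finset.range N, g k x ∂μ := by
  induction N with
  | zero => simp
  | succ N ih =>
    simp only [Finset.sum_range_succ]
    exact (add_le_add_left ih _).trans (le_lintegral_add _ _)

/-- Summing over dyadic scales the normalized indicators of `{d(ξ,η) ≤ 2δ}` is controlled by the
logarithmic kernel `d(ξ,η)^{-D}`. -/
lemma exists_sum_dyadic_le {Z : Type*} [MetricSpace Z] {D c d₀ : ℝ} (hD : 0 < D) (hc : 0 < c)
    (hd₀ : 0 < d₀) : ∃ K : ℝ≥0∞, K ≠ ⊤ ∧ ∀ (N : ℕ) (ξ η : Z),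
      ∑ k ∈ Finset.range N, (if dist η ξ ≤ 2 * (d₀ / 2 ^ k) then
        (ENNReal.ofReal (c * (d₀ / 2 ^ k) ^ D))⁻¹ else 0) ≤ K * edist ξ η ^ (-D) := by
  set q : ℝ := 2 ^ D with hq
  have hq1 : 1 < q := Real.one_lt_rpow (by norm_num) hD
  have hq0 : 0 < q - 1 := by linarith
  have hK : 0 < c⁻¹ * (q * (q / (q - 1))) := by positivity
  refine ⟨ENNReal.ofReal (c⁻¹ * (q * (q / (q - 1)))), ENNReal.ofReal_ne_top,
    fun N ξ η ↦ ?_⟩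
  rcases eq_or_ne ξ η with rfl | hne
  · rw [edist_self, ENNReal.zero_rpow_of_neg (by linarith),
      ENNReal.mul_top (by simpa using hK)]
    exact le_top
  have hd : 0 < dist ξ η := dist_pos.2 hne
  have hpow (k : ℕ) : (d₀ / 2 ^ k) ^ D = d₀ ^ D * (q ^ k)⁻¹ := by
    rw [Real.div_rpow hd₀.le (by positivity), hq, ← Real.rpow_natCast, ← Real.rpow_natCast,
      ← Real.rpow_mul (by norm_num), ← Real.rpow_mul (by norm_num), mul_comm D, div_eq_mul_inv]
  have hd₀D : 0 < d₀ ^ D := Real.rpow_pos_of_pos hd₀ D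
  have hdD : 0 < dist ξ η ^ D := Real.rpow_pos_of_pos hd D
  have hterm (k : ℕ) : (if dist η ξ ≤ 2 * (d₀ / 2 ^ k) then
      (ENNReal.ofReal (c * (d₀ / 2 ^ k) ^ D))⁻¹ else 0) ≤
      ENNReal.ofReal (c⁻¹ * if (d₀ ^ D)⁻¹ * q ^ k ≤ q * (dist ξ η ^ D)⁻¹ then
        (d₀ ^ D)⁻¹ * q ^ k else 0) := by
    by_cases hk : dist η ξ ≤ 2 * (d₀ / 2 ^ k)
    · have h1 : dist ξ η ^ D ≤ q * (d₀ ^ D * (q ^ k)⁻¹) := by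
        rw [← hpow, hq, ← Real.mul_rpow (by norm_num) (by positivity)]
        exact Real.rpow_le_rpow hd.le (by rwa [dist_comm]) hD.le
      have h2 : (d₀ ^ D)⁻¹ * q ^ k ≤ q * (dist ξ η ^ D)⁻¹ := by
        rw [← div_eq_mul_inv, le_div_iff₀ hdD]
        calc (d₀ ^ D)⁻¹ * q ^ k * dist ξ η ^ D
            ≤ (d₀ ^ D)⁻¹ * q ^ k * (q * (d₀ ^ D * (q ^ k)⁻¹)) := by gcongr
          _ = q := by field_simp
      rw [if_pos hk, if_pos h2, ← ENNReal.ofReal_inv_of_pos (by positivity), hpow]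
      refine le_of_eq (congrArg _ ?_)
      rw [mul_inv, mul_inv, inv_inv]
    · rw [if_neg hk]
      exact zero_le
  refine (Finset.sum_le_sum fun k _ ↦ hterm k).trans ?_
  rw [← ENNReal.ofReal_sum_of_nonneg, ← Finset.mul_sum]
  · rw [edist_dist, ENNReal.ofReal_rpow_of_pos hd, ← ENNReal.ofReal_mul hK.le]
    refine ENNReal.ofReal_le_ofReal ?_
    rw [mul_assoc]
    refine mul_le_mul_of_nonneg_left ?_ (by positivity)
    refine (sum_geometric_ite_le hq1 (by positivity) (by positivity) N).trans (le_of_eq ?_)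
    rw [Real.rpow_neg hd.le]
    ring
  · intro k _
    split_ifs <;> positivity

/-- The oscillations at dyadic scales sum up to at most the logarithmic energy. -/
lemma sum_dyadic_oscillation_le {Z : Type*} [MetricSpace Z] [MeasurableSpace Z] [BorelSpace Z]
    (ν : Measure Z) {D p : ℝ} {d : ℕ → ℝ} {w : ℕ → ℝ≥0∞} (hw : ∀ k, w k ≠ ⊤)
    {K : ℝ≥0∞} (hK : K ≠ ⊤) {N : ℕ} (h : ∀ ξ η : Z, ∑ k ∈ Finset.range N,
      (if dist η ξ ≤ d k then w k else 0) ≤ K * edist ξ η ^ (-D)) (f : Z → ℂ) :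
    ∑ k ∈ Finset.range N, ∫⁻ ξ, w k * ∫⁻ η in closedBall ξ (d k), ‖f ξ - f η‖ₑ ^ p ∂ν ∂ν ≤
      K * ∫⁻ ξ, ∫⁻ η, ‖f ξ - f η‖ₑ ^ p * edist ξ η ^ (-D) ∂ν ∂ν := by
  refine (sum_lintegral_le ν _ N).trans ?_
  rw [← lintegral_const_mul' _ _ hK]
  refine lintegral_mono fun ξ ↦ ?_
  have h1 (k : ℕ) : w k * ∫⁻ η in closedBall ξ (d k), ‖f ξ - f η‖ₑ ^ p ∂ν =
      ∫⁻ η, (if dist η ξ ≤ d k then w k else 0) * ‖f ξ - f η‖ₑ ^ p ∂ν := by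
    rw [← lintegral_const_mul' _ _ (hw k), ← lintegral_indicator measurableSet_closedBall]
    refine lintegral_congr fun η ↦ ?_
    by_cases hη : dist η ξ ≤ d k <;> simp [Set.indicator, hη]
  simp only [h1]
  refine (sum_lintegral_le ν _ N).trans ?_
  rw [← lintegral_const_mul' _ _ hK]
  refine lintegral_mono fun η ↦ ?_
  rw [← Finset.sum_mul]
  calc _ ≤ K * edist ξ η ^ (-D) * ‖f ξ - f η‖ₑ ^ p := mul_le_mul_left (h ξ η) _
    _ = _ := by ring

lemma eLpNorm_ofReal_le_iff {α : Type*} [MeasurableSpace α] {μ : Measure α} {p : ℝ}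
    (hp : 0 < p) {f : α → ℂ} {t : ℝ≥0∞} :
    eLpNorm f (ENNReal.ofReal p) μ ≤ t ↔ ∫⁻ x, ‖f x‖ₑ ^ p ∂μ ≤ t ^ p := by
  rw [eLpNorm_eq_lintegral_rpow_enorm_toReal (by simpa using hp) ENNReal.ofReal_ne_top,
    ENNReal.toReal_ofReal hp.le, one_div, ENNReal.rpow_inv_le_iff hp]

/-- **Compact embedding** `W^{log,p}(Z) ↪ Lᵖ(ν)` for `1 < p < ∞` on a bounded
Ahlfors–David `D`-regular metric measure space: every subset of `Lᵖ(ν)` bounded in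
the `W^{log,p}`-norm (`‖φ‖^p = ‖φ‖_{Lᵖ}^p + ∬ |φ(ξ)-φ(η)|^p d(ξ,η)^{-D} dν dν`)
is relatively compact in `Lᵖ(ν)`. -/
theorem compact_embedding_Wlogp
    {Z : Type*} [MetricSpace Z] [MeasurableSpace Z] [BorelSpace Z]
    (ν : Measure Z) (D : ℝ) (hD : 0 < D)
    (hbdd : Bornology.IsBounded (Set.univ : Set Z))
    (c C : ℝ) (hc : 0 < c) (hc1 : c ≤ 1) (hC : 1 ≤ C)
    (hlow : ∀ (ξ : Z) (r : ℝ), 0 ≤ r → r ≤ diam (Set.univ : Set Z) →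
      ENNReal.ofReal (c * r ^ D) ≤ ν (closedBall ξ r))
    (hupp : ∀ (ξ : Z) (r : ℝ), 0 ≤ r → r ≤ diam (Set.univ : Set Z) →
      ν (closedBall ξ r) ≤ ENNReal.ofReal (C * r ^ D))
    (p : ℝ) (hp : 1 < p) [Fact (1 ≤ ENNReal.ofReal p)] :
    ∀ S : Set (Lp ℂ (ENNReal.ofReal p) ν),
      (∃ R : ℝ≥0∞, R ≠ ⊤ ∧ ∀ φ ∈ S,
        (∫⁻ ξ, (‖(φ : Z → ℂ) ξ‖₊ : ℝ≥0∞) ^ p ∂ν) +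
          (∫⁻ ξ, ∫⁻ η, (‖(φ : Z → ℂ) ξ - (φ : Z → ℂ) η‖₊ : ℝ≥0∞) ^ p
            * (edist ξ η) ^ (-D) ∂ν ∂ν) ≤ R) →
      IsCompact (closure S) := by
  rintro S ⟨R, hR, hS⟩
  have hp0 : 0 < p := by linarith
  by_cases hd₀ : diam (Set.univ : Set Z) ≤ 0
  · have hν : ν = 0 := by
      rw [← Measure.measure_univ_eq_zero]
      rcases isEmpty_or_nonempty Z with hZ | ⟨⟨ξ⟩⟩
      · simp [Set.univ_eq_empty_iff.2 hZ]
      · have h0 : diam (Set.univ : Set Z) = 0 := le_antisymm hd₀ diam_nonneg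
        have h1 : (Set.univ : Set Z) ⊆ closedBall ξ 0 := fun y _ ↦
          h0 ▸ dist_le_diam_of_mem hbdd (Set.mem_univ y) (Set.mem_univ ξ)
        have h2 := (measure_mono h1).trans (hupp ξ 0 le_rfl diam_nonneg)
        rwa [Real.zero_rpow hD.ne', mul_zero, ENNReal.ofReal_zero, le_zero_iff] at h2
    subst hν
    have hsub : Subsingleton (Lp ℂ (ENNReal.ofReal p) (0 : Measure Z)) :=
      ⟨fun f g ↦ Lp.ext (by simp [Filter.EventuallyEq])⟩
    exact Set.subsingleton_of_subsingleton.isCompact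
  push Not at hd₀
  set d₀ := diam (Set.univ : Set Z)
  have : Nonempty Z := by
    by_contra h
    rw [not_nonempty_iff] at h
    simp [d₀, Set.univ_eq_empty_iff.2 h] at hd₀
  have : IsFiniteMeasure ν := by
    obtain ⟨ξ⟩ := ‹Nonempty Z›
    have h1 : (Set.univ : Set Z) ⊆ closedBall ξ d₀ := fun y _ ↦
      dist_le_diam_of_mem hbdd (Set.mem_univ y) (Set.mem_univ ξ)
    exact ⟨((measure_mono h1).trans (hupp ξ d₀ hd₀.le le_rfl)).trans_lt ENNReal.ofReal_lt_top⟩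
  have hδ (k : ℕ) : 0 < d₀ / 2 ^ k := by positivity
  have hδ' (k : ℕ) : d₀ / 2 ^ k ≤ d₀ := div_le_self hd₀.le (one_le_pow₀ (by norm_num))
  have hm (k : ℕ) : ENNReal.ofReal (c * (d₀ / 2 ^ k) ^ D) ≠ 0 := by
    have := mul_pos hc (Real.rpow_pos_of_pos (hδ k) D)
    simpa using this
  have hσ (k : ℕ) : ∃ σ : SimpleFunc Z Z, ∀ x, dist x (σ x) ≤ d₀ / 2 ^ k := by
    refine exists_simpleFunc_forall_dist_le (exists_finset_forall_dist_le ν (hm (k + 1)) ?_)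
    intro z
    rw [div_div, ← pow_succ]
    exact hlow z _ (hδ _).le (hδ' _)
  choose σ hσ using hσ
  choose F hFfin hF using fun k ↦
    exists_finiteDimensional_forall_comp_mem ν (ENNReal.ofReal p) (σ k)
  obtain ⟨K, hK, hKsum⟩ := exists_sum_dyadic_le (Z := Z) hD hc hd₀
  suffices TotallyBounded S from this.closure.isCompact_of_isClosed isClosed_closure
  refine totallyBounded_of_forall_exists_finiteDimensional (R := (R ^ p⁻¹).toReal) ?_ ?_
  · intro φ hφ
    rw [Lp.norm_def]
    refine ENNReal.toReal_mono (ENNReal.rpow_ne_top_of_nonneg (by positivity) hR) ?_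
    rw [eLpNorm_ofReal_le_iff hp0, ENNReal.rpow_inv_rpow hp0.ne']
    exact le_self_add.trans (hS φ hφ)
  intro ε hε
  have hεp : ENNReal.ofReal ε ^ p ≠ 0 := by simp [hε]
  obtain ⟨N, hN⟩ := ENNReal.exists_nat_mul_gt hεp (ENNReal.mul_ne_top hK hR)
  refine ⟨⨆ k : Fin N, F k, inferInstance, fun φ hφ ↦ ?_⟩
  have hsum := (sum_dyadic_oscillation_le ν (fun k ↦ ENNReal.inv_ne_top.2 (hm k)) hK
    (hKsum N) φ).trans (mul_le_mul_right (le_add_self.trans (hS φ hφ)) K)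
  obtain ⟨k, hkN, hk⟩ : ∃ k < N, ∫⁻ ξ, (ENNReal.ofReal (c * (d₀ / 2 ^ k) ^ D))⁻¹ *
      ∫⁻ η in closedBall ξ (2 * (d₀ / 2 ^ k)), ‖φ ξ - φ η‖ₑ ^ p ∂ν ∂ν ≤
        ENNReal.ofReal ε ^ p := by
    by_contra! h
    refine hN.not_ge (le_trans ?_ hsum)
    rw [← nsmul_eq_mul]
    simpa using Finset.card_nsmul_le_sum (Finset.range N) _ _
      fun k hk ↦ (h k (Finset.mem_range.1 hk)).le
  let a : Z → ℂ := fun z ↦ ⨍ η in closedBall z (d₀ / 2 ^ k), φ η ∂ν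
  have ha := (σ k |>.map a).memLp_of_isFiniteMeasure (ENNReal.ofReal p) ν
  refine ⟨ha.toLp, le_iSup (fun k : Fin N ↦ F k) ⟨k, hkN⟩ (hF k a), ?_⟩
  rw [← ENNReal.ofReal_le_ofReal_iff hε.le, ← edist_dist, Lp.edist_def,
    eLpNorm_ofReal_le_iff hp0]
  have hφint : Integrable φ ν := (Lp.memLp φ).integrable Fact.out
  refine le_trans (le_of_eq ?_) ((lintegral_enorm_sub_setAverage_le ν hp.le hφint (hσ k) (hm k)
    fun z ↦ hlow z _ (hδ k).le (hδ' k)).trans hk)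
  refine lintegral_congr_ae ?_
  filter_upwards [ha.coeFn_toLp] with ξ hξ
  simp only [Pi.sub_apply, hξ]
  rfl
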